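/- Let K ⊆ ℂ be a subfield and let f be a binary form of degree N over K with nonzero discriminant. Then the set {(A,B) ∈ W_N^0(K) : inv(A,B) = f} is nonempty and G_N(K) acts transitively on it, and the stabilizer in G_N(K) of any element of this set is trivial. -/

import Mathlib

open Matrix MvPolynomial

/-- Pairs of `N × N` matrices over `R`, with `N = 2n+1`. -/
abbrev MPair (n : ℕ) (R : Type*) : Type _ :=
  Matrix (Fin (2*n+1)) (Fin (2*n+1)) R × Matrix (Fin (2*n+1)) (Fin (2*n+1)) R

/-- The action of a matrix `g` on a pair: `g • (A, B) = (g A gᵀ, g B gᵀ)`. -/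
def actPair {R : Type*} [CommRing R] {m : ℕ} (g : Matrix (Fin m) (Fin m) R)
    (w : Matrix (Fin m) (Fin m) R × Matrix (Fin m) (Fin m) R) :
    Matrix (Fin m) (Fin m) R × Matrix (Fin m) (Fin m) R :=
  (g * w.1 * g.transpose, g * w.2 * g.transpose)

/-- Membership in `W_N(R)`: both matrices are symmetric. -/
def WNmem {R : Type*} [CommRing R] (n : ℕ) (w : MPair n R) : Prop := w.1.IsSymm ∧ w.2.IsSymm

/-- The inclusion `Fin n → Fin (2n+1)` of the first `n` indices. -/
def rowIdx (n : ℕ) (i : Fin n) : Fin (2*n+1) := Fin.castLE (by omega) i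

/-- The inclusion `Fin (n+1) → Fin (2n+1)` of the last `n+1` indices. -/
def colIdx (n : ℕ) (j : Fin (n+1)) : Fin (2*n+1) :=
  Fin.cast (by omega) (Fin.natAdd n j)

/-- The coefficient of `x^{N-i} y^i` in a binary `N`-ic form (written in
`MvPolynomial (Fin 2) R`, where variable `0` is `x` and variable `1` is `y`). -/
noncomputable def formCoeff {R : Type*} [CommRing R] (f : MvPolynomial (Fin 2) R) (N i : ℕ) : R :=
  MvPolynomial.coeff (Finsupp.single (0 : Fin 2) (N - i) + Finsupp.single (1 : Fin 2) i) f

/-- The `λ`-invariant of a pair `(A,B)`, computed from the top-right `n × (n+1)` blocks: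
the determinant of the `(n+1) × (n+1)` matrix whose `(i,j)` entry (0-indexed) is `(-1)^i`
times the coefficient of `x^{n-j} y^j` in `det(x A^{(i)} - y B^{(i)})`, where `A^{(i)}`,
`B^{(i)}` are obtained from the top-right `n × (n+1)` blocks by deleting the `i`-th column. -/
noncomputable def lambdaInv {R : Type*} [CommRing R] (n : ℕ) (w : MPair n R) : R :=
  Matrix.det (Matrix.of fun i j : Fin (n+1) =>
    (-1 : R) ^ (i : ℕ) *
      formCoeff
        (Matrix.det (Matrix.of fun r c : Fin n =>
          MvPolynomial.X 0 * MvPolynomial.C (w.1 (rowIdx n r) (colIdx n (i.succAbove c))) -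
          MvPolynomial.X 1 * MvPolynomial.C (w.2 (rowIdx n r) (colIdx n (i.succAbove c)))))
        n (j : ℕ))
/-- Membership in `W_N^0(R)`: symmetric pairs vanishing on the top-left `n × n` block. -/
def W0mem {R : Type*} [CommRing R] (n : ℕ) (w : MPair n R) : Prop :=
  WNmem n w ∧ ∀ i j : Fin (2*n+1), (i : ℕ) < n → (j : ℕ) < n → w.1 i j = 0 ∧ w.2 i j = 0

/-- Membership in `G_N(R) ⊆ SL_N(R)`: determinant one and vanishing top-right `n × (n+1)`
block (1-indexed: `g_{ij} = 0` whenever `i ≤ n` and `j ≥ n+1`). -/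
def GNmem {R : Type*} [CommRing R] (n : ℕ) (g : Matrix (Fin (2*n+1)) (Fin (2*n+1)) R) : Prop :=
  g.det = 1 ∧ ∀ i j : Fin (2*n+1), (i : ℕ) < n → n ≤ (j : ℕ) → g i j = 0

/-- `inv(A,B) = (-1)^n det(x A - y B)`, a binary `N`-ic form realized in
`MvPolynomial (Fin 2) R` (variable `0` is `x`, variable `1` is `y`). -/
noncomputable def invForm {R : Type*} [CommRing R] (n : ℕ) (w : MPair n R) :
    MvPolynomial (Fin 2) R :=
  (-1) ^ n *
    Matrix.det (Matrix.of fun i j : Fin (2*n+1) =>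
      MvPolynomial.X 0 * MvPolynomial.C (w.1 i j) - MvPolynomial.X 1 * MvPolynomial.C (w.2 i j))

theorem Matrix.sq_dvd_det_of_dvd_row_col {ι R : Type*} [Fintype ι] [DecidableEq ι] [CommRing R]
    (M : Matrix ι ι R) (i₀ : ι) (r : R) (h₀ : M i₀ i₀ = 0) (hrow : ∀ j, r ∣ M i₀ j)
    (hcol : ∀ j, r ∣ M j i₀) : r ^ 2 ∣ M.det := by
  rw [det_apply']
  refine Finset.dvd_sum fun σ _ => Dvd.dvd.mul_left ?_ _
  by_cases hσ : σ i₀ = i₀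
  · rw [Finset.prod_eq_zero (Finset.mem_univ i₀) (by rw [hσ, h₀])]
    exact dvd_zero _
  · have hne : σ⁻¹ i₀ ≠ i₀ := fun h => hσ (by rw [Equiv.Perm.inv_eq_iff_eq] at h; exact h.symm)
    rw [← Finset.mul_prod_erase _ _ (Finset.mem_univ i₀),
      ← Finset.mul_prod_erase _ _ (Finset.mem_erase.mpr ⟨hne, Finset.mem_univ _⟩), ← mul_assoc, sq]
    refine Dvd.dvd.mul_right (mul_dvd_mul (hcol _) ?_) _
    simpa using hrow (σ⁻¹ i₀)

theorem Matrix.det_smul_map_sub_map_mul {R ι : Type*} [CommRing R] [Fintype ι] [DecidableEq ι]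
    (C T : Matrix ι ι R) :
    ((Polynomial.X : Polynomial R) • C.map Polynomial.C - (C * T).map Polynomial.C).det =
      Polynomial.C C.det * T.charpoly := by
  rw [charpoly, charmatrix, RingHom.map_det, ← det_mul, RingHom.mapMatrix_apply, mul_sub,
    RingHom.mapMatrix_apply, ← Matrix.map_mul, scalar_apply, ← smul_one_eq_diagonal,
    Matrix.mul_smul, Matrix.mul_one]

/-- An isotropic eigenvector of a self-adjoint operator has an eigenvalue that is at least a double
root of the characteristic polynomial. -/
theorem Matrix.sq_dvd_charpoly_of_isotropic_eigenvector {ι E : Type*} [Fintype ι] [DecidableEq ι]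
    [Field E] {C T : Matrix ι ι E} (hC : C.IsSymm) (hdet : C.det ≠ 0) (hT : Tᵀ * C = C * T)
    {y : ι → E} (hy : y ≠ 0) {θ : E} (hθ : T *ᵥ y = θ • y) (hiso : y ⬝ᵥ C *ᵥ y = 0) :
    (Polynomial.X - Polynomial.C θ) ^ 2 ∣ T.charpoly := by
  obtain ⟨i₀, hi₀⟩ := Function.ne_iff.mp hy
  let φ : E →+* Polynomial E := Polynomial.C
  let G : Matrix ι ι E := (1 : Matrix ι ι E).updateCol i₀ y
  have hG : G.det = y i₀ := by
    rw [← cramer_apply, cramer_one]; rfl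
  let M : Matrix ι ι (Polynomial E) := (Polynomial.X : Polynomial E) • C.map φ - (C * T).map φ
  have hM : Mᵀ = M := by
    simp only [M, transpose_sub, transpose_smul, ← transpose_map, transpose_mul, hT, hC.eq]
  have hMdet : M.det = φ C.det * T.charpoly := det_smul_map_sub_map_mul C T
  have hMy : M *ᵥ (φ ∘ y) = (Polynomial.X - Polynomial.C θ) • (φ ∘ (C *ᵥ y)) := by
    have h : ∀ (A : Matrix ι ι E) (u : ι → E), A.map φ *ᵥ (φ ∘ u) = φ ∘ (A *ᵥ u) := by
      intro A u; ext1 i; exact (RingHom.map_mulVec φ A u i).symm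
    rw [sub_mulVec, smul_mulVec, h, h, ← mulVec_mulVec, hθ, mulVec_smul, sub_smul]
    congr 1
    ext1 i
    simp [φ]
  have hcol : ∀ j, ((G.map φ)ᵀ * M * (G.map φ)) j i₀ =
      (Polynomial.X - Polynomial.C θ) * φ ((Gᵀ *ᵥ (C *ᵥ y)) j) := by
    intro j
    have h1 : (G.map φ).col i₀ = φ ∘ y := by ext1 i; simp [G, col]
    have : ((G.map φ)ᵀ * M * (G.map φ)) j i₀ = ((G.map φ)ᵀ *ᵥ (M *ᵥ ((G.map φ).col i₀))) j := by
      rw [mulVec_mulVec]; rfl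
    rw [this, h1, hMy, mulVec_smul, Pi.smul_apply, smul_eq_mul, RingHom.map_mulVec]
    rfl
  have hdvd : (Polynomial.X - Polynomial.C θ) ^ 2 ∣ ((G.map φ)ᵀ * M * (G.map φ)).det := by
    refine sq_dvd_det_of_dvd_row_col _ i₀ _ ?_ (fun j => ?_) (fun j => ?_)
    · rw [hcol]
      have : (Gᵀ *ᵥ (C *ᵥ y)) i₀ = y ⬝ᵥ C *ᵥ y := by
        simp [mulVec, G, dotProduct]
      rw [this, hiso, map_zero, mul_zero]
    · have : ((G.map φ)ᵀ * M * (G.map φ))ᵀ = (G.map φ)ᵀ * M * (G.map φ) := by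
        rw [transpose_mul, transpose_mul, hM, transpose_transpose, Matrix.mul_assoc]
      rw [← this, transpose_apply, hcol]
      exact dvd_mul_right _ _
    · rw [hcol]
      exact dvd_mul_right _ _
  have hGφ : (G.map φ).det = φ (y i₀) := by rw [← hG, RingHom.map_det]; rfl
  rw [det_mul, det_mul, det_transpose, hMdet, hGφ] at hdvd
  have hunit : ∀ a : E, a ≠ 0 → IsUnit (φ a) := fun a ha => (isUnit_iff_ne_zero.mpr ha).map φ
  rwa [(hunit _ hi₀).dvd_mul_right, (hunit _ hi₀).dvd_mul_left, (hunit _ hdet).dvd_mul_left] at hdvd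

theorem Matrix.transpose_pow_mul_of_selfAdjoint {ι R : Type*} [Fintype ι] [DecidableEq ι]
    [CommRing R] {C T : Matrix ι ι R} (hT : Tᵀ * C = C * T) (i : ℕ) :
    (T ^ i)ᵀ * C = C * T ^ i := by
  induction i with
  | zero => simp
  | succ k ih =>
    rw [pow_succ, transpose_mul, Matrix.mul_assoc, ih, ← Matrix.mul_assoc, hT, Matrix.mul_assoc,
      ← pow_succ', ← pow_succ]

theorem Matrix.pow_mulVec_dotProduct_mulVec_pow_mulVec {ι R : Type*} [Fintype ι] [DecidableEq ι]
    [CommRing R] {C T : Matrix ι ι R} (hT : Tᵀ * C = C * T) (i j : ℕ) (u w : ι → R) :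
    ((T ^ i) *ᵥ u) ⬝ᵥ C *ᵥ ((T ^ j) *ᵥ w) = u ⬝ᵥ C *ᵥ ((T ^ (i + j)) *ᵥ w) := by
  rw [← vecMul_transpose, ← dotProduct_mulVec, mulVec_mulVec, mulVec_mulVec, mulVec_mulVec,
    transpose_pow_mul_of_selfAdjoint hT, Matrix.mul_assoc, ← pow_add]

theorem Matrix.dotProduct_mulVec_comm_of_isSymm {ι R : Type*} [Fintype ι] [CommRing R]
    {C : Matrix ι ι R} (hC : C.IsSymm) (u w : ι → R) : u ⬝ᵥ C *ᵥ w = w ⬝ᵥ C *ᵥ u := by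
  rw [dotProduct_mulVec, ← mulVec_transpose, hC, dotProduct_comm]

/-- The `k`-th moment `vᵀ C Tᵏ v`. -/
def moment {ι R : Type*} [Fintype ι] [DecidableEq ι] [CommRing R] (C T : Matrix ι ι R) (v : ι → R)
    (k : ℕ) : R :=
  v ⬝ᵥ C *ᵥ ((T ^ k) *ᵥ v)

theorem moment_ne_zero_of_algClosed {ι E : Type*} [Fintype ι] [DecidableEq ι]
    [Field E] [IsAlgClosed E] {C T : Matrix ι ι E} (hC : C.IsSymm) (hdet : C.det ≠ 0)
    (hT : Tᵀ * C = C * T) (hsep : T.charpoly.Separable) {v : ι → E} (hv : v ≠ 0) :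
    ∃ k, moment C T v k ≠ 0 := by
  by_contra! h
  let Z : Submodule E (ι → E) := Submodule.span E (Set.range fun k : ℕ => (T ^ k) *ᵥ v)
  have hZT : ∀ z ∈ Z, T.mulVecLin z ∈ Z := by
    have : Z ≤ Z.comap T.mulVecLin := by
      refine Submodule.span_le.mpr ?_
      rintro _ ⟨k, rfl⟩
      refine Submodule.subset_span ⟨k + 1, ?_⟩
      simp [pow_succ']
    exact this
  have hZZ : ∀ z ∈ Z, ∀ z' ∈ Z, z ⬝ᵥ C *ᵥ z' = 0 := by
    intro z hz z' hz'
    induction hz, hz' using Submodule.span_induction₂ with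
    | mem_mem x y hx hy =>
      obtain ⟨i, rfl⟩ := hx
      obtain ⟨j, rfl⟩ := hy
      exact (pow_mulVec_dotProduct_mulVec_pow_mulVec hT i j v v).trans (h _)
    | zero_left => simp
    | zero_right => simp
    | add_left x y z _ _ _ h1 h2 => rw [add_dotProduct, h1, h2, add_zero]
    | add_right x y z _ _ _ h1 h2 => rw [mulVec_add, dotProduct_add, h1, h2, add_zero]
    | smul_left r x y _ _ h => rw [smul_dotProduct, h, smul_zero]
    | smul_right r x y _ _ h => rw [mulVec_smul, dotProduct_smul, h, smul_zero]
  have hvZ : v ∈ Z := Submodule.subset_span ⟨0, by simp⟩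
  have : Nontrivial Z := ⟨⟨v, hvZ⟩, 0, fun h => hv (congrArg Subtype.val h)⟩
  obtain ⟨θ, hθ⟩ := Module.End.exists_eigenvalue (T.mulVecLin.restrict hZT)
  obtain ⟨y, hy⟩ := hθ.exists_hasEigenvector
  have hy0 : (y : ι → E) ≠ 0 := fun h => hy.2 (Subtype.ext h)
  have hθy : T *ᵥ (y : ι → E) = θ • (y : ι → E) := congrArg Subtype.val hy.apply_eq_smul
  have hsq := sq_dvd_charpoly_of_isotropic_eigenvector hC hdet hT hy0 hθy (hZZ _ y.2 _ y.2)
  rw [sq] at hsq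
  exact Polynomial.not_isUnit_X_sub_C θ (hsep.squarefree _ hsq)

theorem exists_moment_ne_zero {ι K : Type*} [Fintype ι] [DecidableEq ι]
    [Field K] {C T : Matrix ι ι K} (hC : C.IsSymm) (hdet : C.det ≠ 0)
    (hT : Tᵀ * C = C * T) (hsep : T.charpoly.Separable) {v : ι → K} (hv : v ≠ 0) :
    ∃ k, moment C T v k ≠ 0 := by
  let φ := algebraMap K (AlgebraicClosure K)
  obtain ⟨k, hk⟩ := moment_ne_zero_of_algClosed (C := C.map φ) (T := T.map φ) (v := φ ∘ v)
    (hC.map φ)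
    (by
      have : (C.map φ).det = φ C.det := (RingHom.map_det φ C).symm
      rw [this]; exact (map_ne_zero φ).mpr hdet)
    (by rw [← transpose_map, ← Matrix.map_mul, hT, Matrix.map_mul])
    (by rw [charpoly_map]; exact hsep.map)
    (fun h => hv (funext fun i => φ.injective ((congrFun h i).trans (map_zero φ).symm)))
  refine ⟨k, fun h => hk ?_⟩
  have h1 : ∀ (A : Matrix ι ι K) (u : ι → K), A.map φ *ᵥ (φ ∘ u) = φ ∘ (A *ᵥ u) := by
    intro A u; ext1 i; exact (RingHom.map_mulVec φ A u i).symm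
  have h2 : (T.map φ) ^ k = (T ^ k).map φ := (map_pow φ.mapMatrix T k).symm
  rw [moment, h2, h1, h1, ← RingHom.map_dotProduct]
  exact (congrArg φ h).trans (map_zero φ)

theorem moment_eq_of_charpoly_eq {ι R : Type*} [Fintype ι] [DecidableEq ι] [CommRing R]
    [Nontrivial R] {C T C' T' : Matrix ι ι R} (hp : T.charpoly = T'.charpoly) {v v' : ι → R}
    (h : ∀ k < Fintype.card ι, moment C T v k = moment C' T' v' k) (k : ℕ) :
    moment C T v k = moment C' T' v' k := by
  rcases isEmpty_or_nonempty ι with hι | hι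
  · simp [moment]
  have key : ∀ (C T : Matrix ι ι R) (v : ι → R), moment C T v k =
      ∑ i ∈ Finset.range (Fintype.card ι),
        (Polynomial.X ^ k %ₘ T.charpoly).coeff i * moment C T v i := by
    intro C T v
    have hdeg : (Polynomial.X ^ k %ₘ T.charpoly).natDegree < Fintype.card ι := by
      rw [← T.charpoly_natDegree_eq_dim]
      refine Polynomial.natDegree_modByMonic_lt _ T.charpoly_monic fun h1 => ?_
      have := T.charpoly_natDegree_eq_dim
      rw [h1, Polynomial.natDegree_one] at this
      exact Fintype.card_ne_zero this.symm
    rw [moment, pow_eq_aeval_mod_charpoly, Polynomial.aeval_eq_sum_range' hdeg, sum_mulVec,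
      mulVec_sum, dotProduct_sum]
    refine Finset.sum_congr rfl fun i _ => ?_
    rw [smul_mulVec, mulVec_smul, dotProduct_smul, smul_eq_mul, moment]
  rw [key, key C', hp]
  exact Finset.sum_congr rfl fun i hi => by rw [h i (Finset.mem_range.mp hi)]

/-- A nondegenerate symmetric matrix `C`, a `C`-self-adjoint matrix `T` with separable
characteristic polynomial and an `n`-dimensional subspace `X` of `K^(2n+1)` that is isotropic for
both `C` and `C * T`. -/
structure IsIsotropicTriple {K : Type*} [Field K] (n : ℕ)
    (C T : Matrix (Fin (2 * n + 1)) (Fin (2 * n + 1)) K)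
    (X : Submodule K (Fin (2 * n + 1) → K)) : Prop where
  isSymm : C.IsSymm
  det_ne_zero : C.det ≠ 0
  selfAdjoint : Tᵀ * C = C * T
  separable : T.charpoly.Separable
  finrank_eq : Module.finrank K X = n
  isotropic : ∀ x ∈ X, ∀ y ∈ X, x ⬝ᵥ C *ᵥ y = 0
  isotropic_mul : ∀ x ∈ X, ∀ y ∈ X, x ⬝ᵥ C *ᵥ (T *ᵥ y) = 0

/-- The vectors `v, T v, …, T^(n-1) v` lie in `X` and `vᵀ C T^(2n) v ≠ 0`. -/
structure IsKrylovVector {K : Type*} [Field K] (n : ℕ)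
    (C T : Matrix (Fin (2 * n + 1)) (Fin (2 * n + 1)) K)
    (X : Submodule K (Fin (2 * n + 1) → K)) (v : Fin (2 * n + 1) → K) : Prop where
  pow_mulVec_mem : ∀ i < n, (T ^ i) *ᵥ v ∈ X
  moment_ne_zero : moment C T v (2 * n) ≠ 0

/-- The matrix with columns `v, T v, T² v, …`. -/
def krylov {K : Type*} [Field K] {N : ℕ} (T : Matrix (Fin N) (Fin N) K) (v : Fin N → K) :
    Matrix (Fin N) (Fin N) K :=
  of fun i j => ((T ^ (j : ℕ)) *ᵥ v) i

theorem krylov_col {K : Type*} [Field K] {N : ℕ} (T : Matrix (Fin N) (Fin N) K) (v : Fin N → K)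
    (j : Fin N) : (krylov T v).col j = (T ^ (j : ℕ)) *ᵥ v := rfl

theorem krylov_smul {K : Type*} [Field K] {N : ℕ} (T : Matrix (Fin N) (Fin N) K) (v : Fin N → K)
    (c : K) : krylov T (c • v) = c • krylov T v := by
  ext i j
  simp [krylov, mulVec_smul]

theorem moment_smul {ι R : Type*} [Fintype ι] [DecidableEq ι] [CommRing R] (C T : Matrix ι ι R)
    (v : ι → R) (c : R) (k : ℕ) : moment C T (c • v) k = c ^ 2 * moment C T v k := by
  simp [moment, mulVec_smul, dotProduct_smul, smul_dotProduct]
  ring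

theorem Matrix.transpose_mul_mul_apply {ι κ R : Type*} [Fintype ι] [CommRing R]
    (P : Matrix ι κ R) (A : Matrix ι ι R) (i j : κ) :
    (Pᵀ * A * P) i j = P.col i ⬝ᵥ A *ᵥ P.col j := by
  rw [Matrix.mul_assoc]
  rfl

theorem krylov_transpose_mul_mul {K : Type*} [Field K] {N : ℕ} {C T : Matrix (Fin N) (Fin N) K}
    (hT : Tᵀ * C = C * T) (v : Fin N → K) :
    (krylov T v)ᵀ * C * krylov T v = of fun i j : Fin N => moment C T v (i + j) := by
  ext i j
  rw [transpose_mul_mul_apply, krylov_col, krylov_col, pow_mulVec_dotProduct_mulVec_pow_mulVec hT]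
  rfl

theorem krylov_transpose_mul_mul_mul {K : Type*} [Field K] {N : ℕ}
    {C T : Matrix (Fin N) (Fin N) K} (hT : Tᵀ * C = C * T) (v : Fin N → K) :
    (krylov T v)ᵀ * (C * T) * krylov T v =
      of fun i j : Fin N => moment C T v (i + (j + 1)) := by
  ext i j
  rw [transpose_mul_mul_apply, krylov_col, krylov_col, ← mulVec_mulVec, mulVec_mulVec _ T,
    ← pow_succ', pow_mulVec_dotProduct_mulVec_pow_mulVec hT]
  rfl

theorem sign_mul_det_hankel {R : Type*} [CommRing R] (n : ℕ) (h : ℕ → R)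
    (h0 : ∀ k < 2 * n, h k = 0) :
    ((Equiv.Perm.sign (Fin.revPerm : Equiv.Perm (Fin (2 * n + 1))) : ℤ) : R) *
      (of fun i j : Fin (2 * n + 1) => h (i + j)).det = h (2 * n) ^ (2 * n + 1) := by
  rw [← det_permute', det_of_isLowerTriangular]
  · have : ∀ i : Fin (2 * n + 1), (i : ℕ) + (Fin.revPerm i : Fin (2 * n + 1)) = 2 * n := by
      intro i; simp [Fin.val_rev]; omega
    simp [submatrix_apply, this, -Fin.revPerm_apply]
  · intro i j hij
    simp only [submatrix_apply, of_apply, Fin.revPerm_apply, Fin.val_rev, id]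
    have : (i : ℕ) < j := hij
    exact h0 _ (by omega)

section

variable {K : Type*} [Field K] {n : ℕ} {C T : Matrix (Fin (2 * n + 1)) (Fin (2 * n + 1)) K}
  {X : Submodule K (Fin (2 * n + 1) → K)}

theorem IsIsotropicTriple.pow_dotProduct_eq_zero (h : IsIsotropicTriple n C T X)
    {v w : Fin (2 * n + 1) → K} (hv : ∀ i < n, (T ^ i) *ᵥ v ∈ X) (hw : ∀ i < n, (T ^ i) *ᵥ w ∈ X)
    {k : ℕ} (hk : k < 2 * n) : v ⬝ᵥ C *ᵥ ((T ^ k) *ᵥ w) = 0 := by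
  obtain ⟨i, rfl | rfl⟩ := Nat.even_or_odd' k
  · rw [two_mul i, ← pow_mulVec_dotProduct_mulVec_pow_mulVec h.selfAdjoint]
    exact h.isotropic _ (hv _ (by omega)) _ (hw _ (by omega))
  · rw [two_mul i, add_assoc i, ← pow_mulVec_dotProduct_mulVec_pow_mulVec h.selfAdjoint, pow_succ',
      ← mulVec_mulVec]
    exact h.isotropic_mul _ (hv _ (by omega)) _ (hw _ (by omega))

theorem IsIsotropicTriple.isKrylovVector (h : IsIsotropicTriple n C T X)
    {v : Fin (2 * n + 1) → K} (hv : v ≠ 0) (hX : ∀ i < n, (T ^ i) *ᵥ v ∈ X) :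
    IsKrylovVector n C T X v := by
  refine ⟨hX, fun h0 => ?_⟩
  obtain ⟨k, hk⟩ := exists_moment_ne_zero h.isSymm h.det_ne_zero h.selfAdjoint h.separable hv
  refine hk ((moment_eq_of_charpoly_eq (C := C) (C' := C) (v' := 0) rfl (fun k hk => ?_) k).trans
    (by simp [moment]))
  rw [Fintype.card_fin] at hk
  rcases Nat.lt_succ_iff_lt_or_eq.mp hk with hk | rfl
  · exact (h.pow_dotProduct_eq_zero hX hX hk).trans (by simp [moment])
  · exact h0.trans (by simp [moment])

/-- The subspace `X` has codimension one in its orthogonal complement. -/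
theorem IsIsotropicTriple.exists_dual (h : IsIsotropicTriple n C T X) :
    ∃ l : (Fin (2 * n + 1) → K) →ₗ[K] K,
      ∀ y, (∀ x ∈ X, x ⬝ᵥ C *ᵥ y = 0) → l y = 0 → y ∈ X := by
  let P := (toBilin' C).orthogonal X
  have hmem : ∀ y, y ∈ P ↔ ∀ x ∈ X, x ⬝ᵥ C *ᵥ y = 0 := by
    intro y
    simp only [P, LinearMap.BilinForm.mem_orthogonal_iff, toBilin'_apply']
  have hP : Module.finrank K P = n + 1 := by
    rw [LinearMap.BilinForm.finrank_orthogonal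
      (LinearMap.BilinForm.nondegenerate_toBilin'_of_det_ne_zero' C h.det_ne_zero),
      h.finrank_eq, Module.finrank_fin_fun]
    omega
  have hXP : X ≤ P := fun y hy => (hmem y).mpr fun x hx => h.isotropic x hx y hy
  have hlt : X < P := lt_of_le_of_ne hXP fun he => by
    have := h.finrank_eq; rw [he, hP] at this; omega
  obtain ⟨z, hzP, hzX⟩ := SetLike.exists_of_lt hlt
  obtain ⟨l, hlz, hl⟩ := Submodule.exists_le_ker_of_notMem hzX
  have hXle : X ≤ P ⊓ LinearMap.ker l := le_inf hXP hl
  have hlt' : P ⊓ LinearMap.ker l < P :=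
    lt_of_le_of_ne inf_le_left fun he => hlz (he.ge hzP).2
  have heq := Submodule.eq_of_le_of_finrank_le hXle (by
    have := Submodule.finrank_lt_finrank_of_lt hlt'
    rw [hP] at this
    rw [h.finrank_eq]
    omega)
  refine ⟨l, fun y hy hly => ?_⟩
  rw [heq]
  exact ⟨(hmem y).mpr hy, hly⟩

theorem IsIsotropicTriple.exists_isKrylovVector (h : IsIsotropicTriple n C T X) (hn : 1 ≤ n) :
    ∃ v, IsKrylovVector n C T X v := by
  obtain ⟨l, hl⟩ := h.exists_dual
  let F : X →ₗ[K] (Fin (n - 1) → K) :=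
    LinearMap.pi fun i => l ∘ₗ (T ^ ((i : ℕ) + 1)).mulVecLin ∘ₗ X.subtype
  have hF : LinearMap.ker F ≠ ⊥ := by
    apply LinearMap.ker_ne_bot_of_finrank_lt
    rw [h.finrank_eq, Module.finrank_fin_fun]
    omega
  obtain ⟨v, hv, hv0⟩ := Submodule.exists_mem_ne_zero_of_ne_bot hF
  refine ⟨v, h.isKrylovVector (fun h0 => hv0 (Subtype.ext h0)) fun i => ?_⟩
  induction i with
  | zero => intro; simp
  | succ i ih =>
    intro hi
    refine hl _ (fun x hx => ?_) ?_
    · rw [pow_succ', ← mulVec_mulVec]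
      exact h.isotropic_mul x hx _ (ih (by omega))
    · exact congrFun (LinearMap.mem_ker.mp hv) ⟨i, by omega⟩

theorem IsKrylovVector.smul {v : Fin (2 * n + 1) → K} (hv : IsKrylovVector n C T X v) {c : K}
    (hc : c ≠ 0) : IsKrylovVector n C T X (c • v) where
  pow_mulVec_mem i hi := by
    rw [mulVec_smul]; exact X.smul_mem _ (hv.pow_mulVec_mem i hi)
  moment_ne_zero := by
    rw [moment_smul]; exact mul_ne_zero (pow_ne_zero _ hc) hv.moment_ne_zero

theorem IsKrylovVector.moment_eq_zero {v : Fin (2 * n + 1) → K} (hv : IsKrylovVector n C T X v)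
    (h : IsIsotropicTriple n C T X) {k : ℕ} (hk : k < 2 * n) : moment C T v k = 0 :=
  h.pow_dotProduct_eq_zero hv.pow_mulVec_mem hv.pow_mulVec_mem hk

theorem IsKrylovVector.det_krylov_sq {v : Fin (2 * n + 1) → K} (hv : IsKrylovVector n C T X v)
    (h : IsIsotropicTriple n C T X) :
    ((Equiv.Perm.sign (Fin.revPerm : Equiv.Perm (Fin (2 * n + 1))) : ℤ) : K) *
      ((krylov T v).det ^ 2 * C.det) = moment C T v (2 * n) ^ (2 * n + 1) := by
  rw [← sign_mul_det_hankel n _ fun k hk => hv.moment_eq_zero h hk,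
    ← krylov_transpose_mul_mul h.selfAdjoint, det_mul, det_mul, det_transpose]
  ring

theorem IsKrylovVector.isUnit_krylov {v : Fin (2 * n + 1) → K} (hv : IsKrylovVector n C T X v)
    (h : IsIsotropicTriple n C T X) : IsUnit (krylov T v).det := by
  rw [isUnit_iff_ne_zero]
  intro h0
  have := hv.det_krylov_sq h
  rw [h0] at this
  exact pow_ne_zero _ hv.moment_ne_zero (by rw [← this]; ring)

theorem IsKrylovVector.span_eq {v : Fin (2 * n + 1) → K} (hv : IsKrylovVector n C T X v)
    (h : IsIsotropicTriple n C T X) :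
    Submodule.span K (Set.range fun i : Fin n => (T ^ (i : ℕ)) *ᵥ v) = X := by
  apply Submodule.eq_of_le_of_finrank_le
  · rw [Submodule.span_le]
    rintro _ ⟨i, rfl⟩
    exact hv.pow_mulVec_mem i i.2
  · have hli : LinearIndependent K (krylov T v).col :=
      linearIndependent_cols_iff_isUnit.mpr
        ((isUnit_iff_isUnit_det _).mpr (hv.isUnit_krylov h))
    have := hli.comp (Fin.castLE (by omega : n ≤ 2 * n + 1)) (Fin.castLE_injective _)
    have h2 := finrank_span_eq_card this
    rw [Fintype.card_fin] at h2
    rw [h.finrank_eq]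
    exact h2.ge

theorem mulVec_krylov_of_commute {S : Matrix (Fin (2 * n + 1)) (Fin (2 * n + 1)) K}
    (hS : T * S = S * T) (v : Fin (2 * n + 1) → K) : krylov T (S *ᵥ v) = S * krylov T v := by
  ext i j
  have : Commute (T ^ (j : ℕ)) S := Commute.pow_left hS _
  change ((T ^ (j : ℕ)) *ᵥ (S *ᵥ v)) i = (S *ᵥ ((T ^ (j : ℕ)) *ᵥ v)) i
  rw [mulVec_mulVec, mulVec_mulVec, this.eq]

/-- Isometries of an isotropic triple of determinant one are trivial. -/
theorem IsIsotropicTriple.eq_one_of_isometry (h : IsIsotropicTriple n C T X) (hn : 1 ≤ n)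
    {S : Matrix (Fin (2 * n + 1)) (Fin (2 * n + 1)) K} (hdet : S.det = 1)
    (hC : Sᵀ * C * S = C) (hCT : Sᵀ * (C * T) * S = C * T) (hX : ∀ x ∈ X, S *ᵥ x ∈ X) :
    S = 1 := by
  obtain ⟨v, hv⟩ := h.exists_isKrylovVector hn
  have hcomm : T * S = S * T := by
    have h1 : (Sᵀ * C) * (T * S) = (Sᵀ * C) * (S * T) := by
      calc (Sᵀ * C) * (T * S) = Sᵀ * (C * T) * S := by simp only [Matrix.mul_assoc]
        _ = Sᵀ * C * S * T := by rw [hCT, hC]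
        _ = _ := by simp only [Matrix.mul_assoc]
    have hu : IsUnit (Sᵀ * C) := by
      rw [isUnit_iff_isUnit_det, det_mul, det_transpose, hdet, one_mul]
      exact isUnit_iff_ne_zero.mpr h.det_ne_zero
    exact hu.mul_left_cancel h1
  have hSv : ∀ i < n, (T ^ i) *ᵥ (S *ᵥ v) ∈ X := by
    intro i hi
    have : Commute (T ^ i) S := Commute.pow_left hcomm _
    rw [mulVec_mulVec, this.eq, ← mulVec_mulVec]
    exact hX _ (hv.pow_mulVec_mem i hi)
  let c := (S *ᵥ v) ⬝ᵥ C *ᵥ ((T ^ (2 * n)) *ᵥ v) / moment C T v (2 * n)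
  have hc : S *ᵥ v = c • v := by
    rw [← sub_eq_zero]
    have hu : IsUnit ((krylov T v)ᵀ * C) := by
      rw [isUnit_iff_isUnit_det, det_mul, det_transpose]
      exact (hv.isUnit_krylov h).mul (isUnit_iff_ne_zero.mpr h.det_ne_zero)
    refine mulVec_injective_iff_isUnit.mpr hu ?_
    rw [mulVec_zero, ← mulVec_mulVec]
    ext1 j
    change (krylov T v).col j ⬝ᵥ C *ᵥ _ = 0
    rw [krylov_col, dotProduct_mulVec_comm_of_isSymm h.isSymm, sub_dotProduct, smul_dotProduct]
    rcases Nat.lt_succ_iff_lt_or_eq.mp j.2 with hj | hj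
    · rw [h.pow_dotProduct_eq_zero hSv hv.pow_mulVec_mem hj,
        h.pow_dotProduct_eq_zero hv.pow_mulVec_mem hv.pow_mulVec_mem hj, smul_zero, sub_zero]
    · rw [hj, smul_eq_mul, sub_eq_zero]
      exact (div_mul_cancel₀ _ hv.moment_ne_zero).symm
  have hS : S = c • 1 := by
    have h1 := mulVec_krylov_of_commute hcomm v
    rw [hc, krylov_smul] at h1
    have hu : IsUnit (krylov T v) := (isUnit_iff_isUnit_det _).mpr (hv.isUnit_krylov h)
    refine hu.mul_right_cancel ?_
    rw [← h1, smul_mul, Matrix.one_mul]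
  have hc2 : c ^ 2 = 1 := by
    have h1 : c ^ 2 * moment C T v (2 * n) = moment C T v (2 * n) := by
      have h2 : (T ^ (2 * n)) *ᵥ (S *ᵥ v) = S *ᵥ ((T ^ (2 * n)) *ᵥ v) := by
        rw [mulVec_mulVec, (Commute.pow_left hcomm _ : Commute _ S).eq, mulVec_mulVec]
      rw [← moment_smul, ← hc, moment, h2, ← vecMul_transpose, ← dotProduct_mulVec,
        mulVec_mulVec, mulVec_mulVec, hC, moment]
    exact mul_right_cancel₀ hv.moment_ne_zero (h1.trans (one_mul _).symm)
  have hcN : c ^ (2 * n + 1) = 1 := by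
    rw [hS, det_smul, det_one, mul_one, Fintype.card_fin] at hdet
    exact hdet
  rw [pow_succ, pow_mul, hc2, one_pow, one_mul] at hcN
  rw [hS, hcN, one_smul]

variable {C' T' : Matrix (Fin (2 * n + 1)) (Fin (2 * n + 1)) K}

/-- Two Krylov vectors with the same top moment are matched by an isometry. -/
theorem IsKrylovVector.exists_isometry {v v' : Fin (2 * n + 1) → K}
    (hv : IsKrylovVector n C T X v) (hv' : IsKrylovVector n C' T' X v')
    (h : IsIsotropicTriple n C T X) (h' : IsIsotropicTriple n C' T' X)
    (hp : T.charpoly = T'.charpoly) (hm : moment C T v (2 * n) = moment C' T' v' (2 * n)) :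
    ∃ S : Matrix (Fin (2 * n + 1)) (Fin (2 * n + 1)) K, S * krylov T' v' = krylov T v ∧
      Sᵀ * C * S = C' ∧ Sᵀ * (C * T) * S = C' * T' ∧ ∀ x ∈ X, S *ᵥ x ∈ X := by
  have hmom : ∀ k, moment C T v k = moment C' T' v' k := by
    refine moment_eq_of_charpoly_eq hp fun k hk => ?_
    rw [Fintype.card_fin] at hk
    rcases Nat.lt_succ_iff_lt_or_eq.mp hk with hk | rfl
    · rw [hv.moment_eq_zero h hk, hv'.moment_eq_zero h' hk]
    · exact hm
  have hu := hv'.isUnit_krylov h'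
  have hu' : IsUnit (krylov T' v')ᵀ := by
    rw [isUnit_iff_isUnit_det, det_transpose]; exact hu
  obtain ⟨S, hS⟩ : ∃ S, S * krylov T' v' = krylov T v :=
    ⟨krylov T v * (krylov T' v')⁻¹, nonsing_inv_mul_cancel_right _ _ hu⟩
  have hconj : ∀ A B : Matrix (Fin (2 * n + 1)) (Fin (2 * n + 1)) K,
      (krylov T v)ᵀ * A * krylov T v = (krylov T' v')ᵀ * B * krylov T' v' →
      Sᵀ * A * S = B := by
    intro A B hAB
    refine hu'.mul_left_cancel (((isUnit_iff_isUnit_det _).mpr hu).mul_right_cancel ?_)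
    rw [← hAB, ← hS, transpose_mul]
    simp only [Matrix.mul_assoc]
  refine ⟨S, hS, hconj _ _ ?_, hconj _ _ ?_, ?_⟩
  · simp only [krylov_transpose_mul_mul h.selfAdjoint, krylov_transpose_mul_mul h'.selfAdjoint,
      hmom]
  · simp only [krylov_transpose_mul_mul_mul h.selfAdjoint,
      krylov_transpose_mul_mul_mul h'.selfAdjoint, hmom]
  · have : X ≤ X.comap S.mulVecLin := by
      conv_lhs => rw [← hv'.span_eq h']
      rw [Submodule.span_le]
      rintro _ ⟨i, rfl⟩
      have h1 : S *ᵥ ((T' ^ (i : ℕ)) *ᵥ v') = (T ^ (i : ℕ)) *ᵥ v :=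
        congrArg (fun M => M.col (Fin.castLE (by omega : n ≤ 2 * n + 1) i)) hS
      change S *ᵥ ((T' ^ (i : ℕ)) *ᵥ v') ∈ X
      rw [h1]
      exact hv.pow_mulVec_mem i i.2
    exact this

theorem IsIsotropicTriple.exists_isometry (h : IsIsotropicTriple n C T X)
    (h' : IsIsotropicTriple n C' T' X) (hn : 1 ≤ n) (hp : T.charpoly = T'.charpoly)
    (hd : C.det = C'.det) :
    ∃ S : Matrix (Fin (2 * n + 1)) (Fin (2 * n + 1)) K, S.det = 1 ∧
      Sᵀ * C * S = C' ∧ Sᵀ * (C * T) * S = C' * T' ∧ ∀ x ∈ X, S *ᵥ x ∈ X := by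
  obtain ⟨v, hv⟩ := h.exists_isKrylovVector hn
  obtain ⟨w, hw⟩ := h'.exists_isKrylovVector hn
  have hs := hv.moment_ne_zero
  have hs' := hw.moment_ne_zero
  set s := moment C T v (2 * n) with hs_def
  set s' := moment C' T' w (2 * n) with hs_def'
  let c := (krylov T v).det * s' ^ n / ((krylov T' w).det * s ^ n)
  have hPv : (krylov T v).det ≠ 0 := (hv.isUnit_krylov h).ne_zero
  have hPw : (krylov T' w).det ≠ 0 := (hw.isUnit_krylov h').ne_zero
  have hc0 : c ≠ 0 :=
    div_ne_zero (mul_ne_zero hPv (pow_ne_zero _ hs')) (mul_ne_zero hPw (pow_ne_zero _ hs))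
  have hc : c ^ 2 * s' = s := by
    have h1 := hv.det_krylov_sq h
    have h2 := hw.det_krylov_sq h'
    rw [← hs_def] at h1
    rw [← hs_def', ← hd] at h2
    have h3 : (krylov T v).det ^ 2 * s' ^ (2 * n + 1) =
        (krylov T' w).det ^ 2 * s ^ (2 * n + 1) := by
      rw [← h1, ← h2]; ring
    have h4 : c ^ 2 * s' * ((krylov T' w).det ^ 2 * s ^ (2 * n)) =
        (krylov T v).det ^ 2 * s' ^ (2 * n + 1) := by
      simp only [c]
      field_simp
      ring
    refine mul_right_cancel₀ (mul_ne_zero (pow_ne_zero 2 hPw) (pow_ne_zero (2 * n) hs)) ?_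
    rw [h4, h3]
    ring
  have hv' := hw.smul hc0
  obtain ⟨S, -, hSC, hSCT, hSX⟩ :=
    hv.exists_isometry hv' h h' hp (by rw [moment_smul]; exact hc.symm)
  have hdet : S.det = 1 ∨ S.det = -1 := by
    rw [← mul_self_eq_one_iff]
    refine mul_right_cancel₀ h.det_ne_zero ?_
    have h1 := congrArg det hSC
    rw [det_mul, det_mul, det_transpose, ← hd] at h1
    linear_combination h1
  rcases hdet with hdet | hdet
  · exact ⟨S, hdet, hSC, hSCT, hSX⟩
  · refine ⟨-S, ?_, by simpa using hSC, by simpa using hSCT, fun x hx => ?_⟩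
    · rw [det_neg, hdet, Fintype.card_fin, pow_succ, pow_mul]; simp
    · rw [neg_mulVec]; exact X.neg_mem (hSX x hx)

end

theorem Squarefree.of_homogenize {K : Type*} [Field K] {p : Polynomial K} {N : ℕ}
    (hp : p.natDegree ≤ N) (h : Squarefree (p.homogenize N)) : Squarefree p := by
  have hp0 : p ≠ 0 := by
    rintro rfl
    rw [Polynomial.homogenize_zero] at h
    exact not_squarefree_zero h
  intro q hq
  obtain ⟨r, rfl⟩ := hq
  have hqr : q ≠ 0 ∧ r ≠ 0 := by
    constructor <;> rintro rfl <;> simp at hp0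
  have hdeg : q.natDegree + q.natDegree + r.natDegree ≤ N := by
    rwa [Polynomial.natDegree_mul (mul_ne_zero hqr.1 hqr.1) hqr.2,
      Polynomial.natDegree_mul hqr.1 hqr.1] at hp
  obtain ⟨d, rfl⟩ := Nat.exists_eq_add_of_le hdeg
  rw [add_assoc, Polynomial.homogenize_mul _ _ Polynomial.natDegree_mul_le (by omega),
    Polynomial.homogenize_mul _ _ le_rfl le_rfl] at h
  have hu := (h _ (dvd_mul_right _ _)).map (aeval ![Polynomial.X, (1 : Polynomial K)])
  rwa [Polynomial.aeval_homogenize_X_one _ le_rfl] at hu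

theorem Squarefree.map_mulEquiv {R S : Type*} [CommMonoid R] [CommMonoid S]
    (e : R ≃* S) {a : R} (h : Squarefree a) : Squarefree (e a) := by
  intro q hq
  have : e.symm q * e.symm q ∣ a := by
    simpa using map_dvd e.symm hq
  simpa using (h _ this).map e

/-- The shear `y ↦ y + b x` of binary forms. -/
noncomputable def shearEquiv {R : Type*} [CommRing R] (b : R) :
    MvPolynomial (Fin 2) R ≃ₐ[R] MvPolynomial (Fin 2) R :=
  AlgEquiv.ofAlgHom (aeval ![X 0, C b * X 0 + X 1]) (aeval ![X 0, X 1 - C b * X 0])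
    (by ext i; fin_cases i <;> simp) (by ext i; fin_cases i <;> simp)

theorem shearEquiv_apply {R : Type*} [CommRing R] (b : R) (f : MvPolynomial (Fin 2) R) :
    shearEquiv b f = aeval ![X 0, C b * X 0 + X 1] f := rfl

theorem squarefree_aeval_shear {K : Type*} [Field K] {f : MvPolynomial (Fin 2) K} {N : ℕ}
    (hf : f.IsHomogeneous N) (hsf : Squarefree f) (b : K) :
    Squarefree (aeval ![Polynomial.X, Polynomial.C b * Polynomial.X + 1] f) := by
  have h1 : Squarefree (shearEquiv b f) := hsf.map_mulEquiv (shearEquiv b).toMulEquiv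
  have h2 : (shearEquiv b f).IsHomogeneous N := by
    have := hf.aeval (S := K) (τ := Fin 2) ![X 0, C b * X 0 + X 1] (n := 1) (by
      intro i
      fin_cases i
      · exact isHomogeneous_X _ _
      · exact ((isHomogeneous_C_mul_X b 0)).add (isHomogeneous_X _ _))
    rwa [one_mul, ← shearEquiv_apply] at this
  have h3 : aeval ![Polynomial.X, (1 : Polynomial K)] (shearEquiv b f) =
      aeval ![Polynomial.X, Polynomial.C b * Polynomial.X + 1] f := by
    have : ((aeval ![Polynomial.X, (1 : Polynomial K)]).comp (shearEquiv b).toAlgHom) =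
        aeval ![Polynomial.X, Polynomial.C b * Polynomial.X + 1] := by
      ext i; fin_cases i <;> simp [shearEquiv, Polynomial.C_eq_algebraMap]
    exact DFunLike.congr_fun this f
  rw [← Polynomial.homogenize_eq_of_isHomogeneous h2 h3] at h1
  refine Squarefree.of_homogenize ?_ h1
  have := aeval_natDegree_le f hf.totalDegree_le
    ![Polynomial.X, Polynomial.C b * Polynomial.X + 1] (n := 1) (by
      intro i
      fin_cases i
      · exact Polynomial.natDegree_X_le
      · simpa using Polynomial.natDegree_linear_le (a := b) (b := 1))
  simpa using this

theorem MvPolynomial.IsHomogeneous.homogenize_aeval_X_one {R : Type*} [CommRing R]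
    {f : MvPolynomial (Fin 2) R} {N : ℕ} (hf : f.IsHomogeneous N) :
    (MvPolynomial.aeval ![Polynomial.X, (1 : Polynomial R)] f).homogenize N = f :=
  Polynomial.homogenize_eq_of_isHomogeneous hf rfl

theorem MvPolynomial.IsHomogeneous.natDegree_aeval_X_one_le {R : Type*} [CommRing R]
    {f : MvPolynomial (Fin 2) R} {N : ℕ} (hf : f.IsHomogeneous N) :
    (MvPolynomial.aeval ![Polynomial.X, (1 : Polynomial R)] f).natDegree ≤ N := by
  have := aeval_natDegree_le f hf.totalDegree_le ![Polynomial.X, (1 : Polynomial R)] (n := 1) (by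
      intro i
      fin_cases i
      · exact Polynomial.natDegree_X_le
      · simp)
  simpa using this

theorem MvPolynomial.IsHomogeneous.exists_eval_one_ne_zero {K : Type*} [Field K] [Infinite K]
    {f : MvPolynomial (Fin 2) K} {N : ℕ} (hf : f.IsHomogeneous N) (h0 : f ≠ 0) :
    ∃ b : K, MvPolynomial.eval ![1, b] f ≠ 0 := by
  have h1 : f * (X 0 * X 1) ≠ 0 := mul_ne_zero h0 (mul_ne_zero (X_ne_zero _) (X_ne_zero _))
  obtain ⟨z, hz⟩ : ∃ z, MvPolynomial.eval z (f * (X 0 * X 1)) ≠ 0 := by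
    by_contra! h
    exact h1 (MvPolynomial.funext fun z => by rw [h, map_zero])
  simp only [map_mul, eval_X, ne_eq, mul_eq_zero, not_or] at hz
  obtain ⟨hz, hz0, hz1⟩ := hz
  refine ⟨z 1 / z 0, fun h => hz ?_⟩
  rw [← hf.homogenize_aeval_X_one] at h ⊢
  rw [Polynomial.eval_homogenize hf.natDegree_aeval_X_one_le _ (by simp [hz0, hz1])] at h
  rw [Polynomial.eval_homogenize hf.natDegree_aeval_X_one_le _ hz1]
  simp [hz0, hz1] at h
  simp [h]

theorem aeval_invForm {R S : Type*} [CommRing R] [CommRing S] [Algebra R S] (n : ℕ)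
    (w : MPair n R) (x y : S) :
    aeval ![x, y] (invForm n w) =
      (-1) ^ n * (x • w.1.map (algebraMap R S) - y • w.2.map (algebraMap R S)).det := by
  rw [invForm, map_mul, AlgHom.map_det]
  congr 2
  · simp
  · ext i j
    simp

section

variable {K : Type*} [Field K] {n : ℕ} {f : MvPolynomial (Fin 2) K} {w : MPair n K}

/-- The subspace spanned by the first `n` standard basis vectors. -/
noncomputable abbrev firstSpan (K : Type*) [Field K] (n : ℕ) :
    Submodule K (Fin (2 * n + 1) → K) :=
  Pi.spanSubset K {i | (i : ℕ) < n}

theorem mem_firstSpan {x : Fin (2 * n + 1) → K} :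
    x ∈ firstSpan K n ↔ ∀ i : Fin (2 * n + 1), n ≤ (i : ℕ) → x i = 0 := by
  simp [Pi.mem_spanSubset_iff]

theorem finrank_firstSpan : Module.finrank K (firstSpan K n) = n := by
  rw [Pi.dim_spanSubset]
  have : {i : Fin (2 * n + 1) | (i : ℕ) < n} =
      Set.range (Fin.castLE (by omega : n ≤ 2 * n + 1)) := by
    ext i
    simp [Fin.range_castLE]
  rw [this, Set.ncard_range_of_injective (Fin.castLE_injective _)]
  simp

theorem det_sub_smul (hw : invForm n w = f) (b : K) :
    (w.1 - b • w.2).det = (-1) ^ n * eval ![1, b] f := by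
  have := aeval_invForm (S := K) n w 1 b
  rw [hw] at this
  simp only [Algebra.algebraMap_self, RingHom.coe_id, map_id, one_smul] at this
  rw [← aeval_eq_eval, this, ← mul_assoc, ← mul_pow]
  simp

theorem aeval_shear_eq (hw : invForm n w = f) {b : K} {T : Matrix _ _ K}
    (hT : (w.1 - b • w.2) * T = w.2) :
    aeval ![Polynomial.X, Polynomial.C b * Polynomial.X + 1] f =
      Polynomial.C (eval ![1, b] f) * T.charpoly := by
  rw [← hw, aeval_invForm, hw]
  have : (Polynomial.X : Polynomial K) • w.1.map (algebraMap K (Polynomial K)) -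
      (Polynomial.C b * Polynomial.X + 1) • w.2.map (algebraMap K (Polynomial K)) =
      (Polynomial.X : Polynomial K) • (w.1 - b • w.2).map Polynomial.C -
        ((w.1 - b • w.2) * T).map Polynomial.C := by
    rw [hT]
    ext1 i j
    simp [Polynomial.algebraMap_eq]
    ring
  rw [this, det_smul_map_sub_map_mul, det_sub_smul hw, map_mul, ← mul_assoc, ← mul_assoc]
  simp [← mul_pow]

theorem dotProduct_mulVec_eq_zero_of_firstSpan {A : Matrix (Fin (2 * n + 1)) (Fin (2 * n + 1)) K}
    (hA : ∀ i j : Fin (2 * n + 1), (i : ℕ) < n → (j : ℕ) < n → A i j = 0) {x y}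
    (hx : x ∈ firstSpan K n) (hy : y ∈ firstSpan K n) : x ⬝ᵥ A *ᵥ y = 0 := by
  rw [mem_firstSpan] at hx hy
  refine Finset.sum_eq_zero fun i _ => ?_
  by_cases hi : (i : ℕ) < n
  · refine mul_eq_zero_of_right _ ?_
    rw [mulVec, dotProduct]
    refine Finset.sum_eq_zero fun j _ => ?_
    by_cases hj : (j : ℕ) < n
    · rw [hA i j hi hj, zero_mul]
    · rw [hy j (by omega), mul_zero]
  · rw [hx i (by omega), zero_mul]

theorem isIsotropicTriple_of_invForm_eq [CharZero K] (hf : f.IsHomogeneous (2 * n + 1))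
    (hsf : Squarefree f) (hw0 : W0mem n w) (hw : invForm n w = f) {b : K}
    (hb : eval ![1, b] f ≠ 0) {T : Matrix _ _ K} (hT : (w.1 - b • w.2) * T = w.2) :
    IsIsotropicTriple n (w.1 - b • w.2) T (firstSpan K n) where
  isSymm := hw0.1.1.sub (hw0.1.2.smul b)
  det_ne_zero := by
    rw [det_sub_smul hw]
    exact mul_ne_zero (pow_ne_zero _ (neg_ne_zero.mpr one_ne_zero)) hb
  selfAdjoint := by
    have h := hw0.1.2
    rw [← hT, Matrix.IsSymm, transpose_mul, (hw0.1.1.sub (hw0.1.2.smul b)).eq] at h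
    exact h
  separable := by
    have h := squarefree_aeval_shear hf hsf b
    rw [aeval_shear_eq hw hT] at h
    exact PerfectField.separable_iff_squarefree.mpr (h.squarefree_of_dvd (dvd_mul_left _ _))
  finrank_eq := finrank_firstSpan
  isotropic x hx y hy := by
    refine dotProduct_mulVec_eq_zero_of_firstSpan (fun i j hi hj => ?_) hx hy
    simp [hw0.2 i j hi hj]
  isotropic_mul x hx y hy := by
    rw [mulVec_mulVec, hT]
    exact dotProduct_mulVec_eq_zero_of_firstSpan (fun i j hi hj => (hw0.2 i j hi hj).2) hx hy

theorem exists_mul_eq (hw : invForm n w = f) {b : K} (hb : eval ![1, b] f ≠ 0) :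
    ∃ T, (w.1 - b • w.2) * T = w.2 := by
  refine ⟨(w.1 - b • w.2)⁻¹ * w.2, mul_nonsing_inv_cancel_left _ _ ?_⟩
  rw [det_sub_smul hw, isUnit_iff_ne_zero]
  exact mul_ne_zero (pow_ne_zero _ (neg_ne_zero.mpr one_ne_zero)) hb

theorem GNmem_transpose_iff {S : Matrix (Fin (2 * n + 1)) (Fin (2 * n + 1)) K} :
    GNmem n Sᵀ ↔ S.det = 1 ∧ ∀ x ∈ firstSpan K n, S *ᵥ x ∈ firstSpan K n := by
  rw [GNmem, det_transpose]
  refine and_congr_right fun _ => ⟨fun h x hx => ?_, fun h i j hi hj => ?_⟩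
  · rw [mem_firstSpan] at hx ⊢
    intro j hj
    rw [mulVec, dotProduct]
    refine Finset.sum_eq_zero fun i _ => ?_
    by_cases hi : (i : ℕ) < n
    · rw [← transpose_apply S, h i j hi hj, zero_mul]
    · rw [hx i (by omega), mul_zero]
  · have := mem_firstSpan.mp (h (Pi.single i 1) (mem_firstSpan.mpr fun k hk =>
      Pi.single_eq_of_ne (by rintro rfl; omega) _)) j hj
    simpa using this

theorem exists_GNmem_actPair_eq [CharZero K] (hn : 1 ≤ n) (hf : f.IsHomogeneous (2 * n + 1))
    (hsf : Squarefree f) {w' : MPair n K} (hw0 : W0mem n w) (hw0' : W0mem n w')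
    (hw : invForm n w = f) (hw' : invForm n w' = f) :
    ∃ g, GNmem n g ∧ actPair g w = w' := by
  obtain ⟨b, hb⟩ := hf.exists_eval_one_ne_zero hsf.ne_zero
  obtain ⟨T, hT⟩ := exists_mul_eq hw hb
  obtain ⟨T', hT'⟩ := exists_mul_eq hw' hb
  have h := isIsotropicTriple_of_invForm_eq hf hsf hw0 hw hb hT
  have h' := isIsotropicTriple_of_invForm_eq hf hsf hw0' hw' hb hT'
  have hp : T.charpoly = T'.charpoly :=
    mul_left_cancel₀ (Polynomial.C_ne_zero.mpr hb)
      ((aeval_shear_eq hw hT).symm.trans (aeval_shear_eq hw' hT'))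
  obtain ⟨S, hdet, hC, hCT, hX⟩ :=
    h.exists_isometry h' hn hp ((det_sub_smul hw b).trans (det_sub_smul hw' b).symm)
  rw [hT, hT'] at hCT
  refine ⟨Sᵀ, GNmem_transpose_iff.mpr ⟨hdet, hX⟩, Prod.ext ?_ ?_⟩
  · rw [mul_sub, sub_mul, Matrix.mul_smul, Matrix.smul_mul, hCT, sub_left_inj] at hC
    exact hC
  · exact hCT

theorem eq_one_of_actPair_eq [CharZero K] (hn : 1 ≤ n) (hf : f.IsHomogeneous (2 * n + 1))
    (hsf : Squarefree f) {g : Matrix _ _ K} (hg : GNmem n g) (hw0 : W0mem n w)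
    (hw : invForm n w = f) (hgw : actPair g w = w) : g = 1 := by
  obtain ⟨b, hb⟩ := hf.exists_eval_one_ne_zero hsf.ne_zero
  obtain ⟨T, hT⟩ := exists_mul_eq hw hb
  have h := isIsotropicTriple_of_invForm_eq hf hsf hw0 hw hb hT
  have hA : g * w.1 * gᵀ = w.1 := congrArg Prod.fst hgw
  have hB : g * w.2 * gᵀ = w.2 := congrArg Prod.snd hgw
  rw [← transpose_transpose g] at hg
  obtain ⟨hdet, hX⟩ := GNmem_transpose_iff.mp hg
  have hg1 : gᵀ = 1 := h.eq_one_of_isometry hn hdet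
    (by rw [transpose_transpose, mul_sub, sub_mul, Matrix.mul_smul, Matrix.smul_mul, hA, hB])
    (by rw [transpose_transpose, hT, hB]) hX
  rw [← transpose_transpose g, hg1, transpose_one]

end

theorem Matrix.det_fromBlocks_zero_transpose {ι R : Type*} [Fintype ι] [DecidableEq ι] [CommRing R]
    (M S : Matrix ι ι R) :
    (fromBlocks 0 M Mᵀ S).det = (-1) ^ Fintype.card ι * M.det ^ 2 := by
  have h : fromBlocks 0 M Mᵀ S * (fromBlocks 1 (-1) 0 1 * fromBlocks 1 0 1 1 *
      fromBlocks 1 (-1) 0 1) = fromBlocks M 0 S (-Mᵀ) := by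
    simp [fromBlocks_multiply]
  have hJ := congrArg det h
  rw [det_mul, det_mul, det_mul, det_fromBlocks_zero₁₂, det_fromBlocks_zero₁₂,
    det_fromBlocks_zero₂₁, det_neg, det_transpose] at hJ
  simp only [det_one, mul_one] at hJ
  rw [hJ]
  ring

/-- The determinant of a symmetric matrix bordering a matrix with a zero diagonal block. -/
theorem Matrix.det_fromBlocks_bordered {ι K : Type*} [Fintype ι] [DecidableEq ι] [Field K]
    {M : Matrix ι ι K} (S : Matrix ι ι K) (m b : ι → K) (τ : K) (hM : M.det ≠ 0)
    (hb : M *ᵥ b = m) :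
    (fromBlocks (fromBlocks 0 M Mᵀ S) (replicateCol (Fin 1) (Sum.elim m 0))
      (replicateRow (Fin 1) (Sum.elim m 0)) (of fun _ _ => τ)).det =
      (-1) ^ Fintype.card ι * M.det ^ 2 * (τ + b ⬝ᵥ S *ᵥ b) := by
  have hdet := det_fromBlocks_zero_transpose M S
  have hu : IsUnit (fromBlocks 0 M Mᵀ S).det := by
    rw [hdet]
    exact ((isUnit_one.neg).pow _).mul ((isUnit_iff_ne_zero.mpr hM).pow 2)
  obtain ⟨a, ha⟩ : ∃ a, Mᵀ *ᵥ a = -(S *ᵥ b) := by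
    refine ⟨(Mᵀ)⁻¹ *ᵥ -(S *ᵥ b), ?_⟩
    rw [mulVec_mulVec, mul_nonsing_inv _ (by rw [det_transpose]; exact hM.isUnit), one_mulVec]
  have hab : fromBlocks 0 M Mᵀ S *ᵥ Sum.elim a b = Sum.elim m 0 := by
    rw [fromBlocks_mulVec]
    simp [ha, hb]
  have hinv : (fromBlocks 0 M Mᵀ S)⁻¹ *ᵥ Sum.elim m 0 = Sum.elim a b := by
    rw [← hab, mulVec_mulVec, nonsing_inv_mul _ hu, one_mulVec]
  let _ := invertibleOfIsUnitDet _ hu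
  rw [det_fromBlocks₁₁, hdet, invOf_eq_nonsing_inv, Matrix.mul_assoc, ← replicateCol_mulVec, hinv,
    det_fin_one]
  congr 1
  have hma : Sum.elim m (0 : ι → K) ⬝ᵥ Sum.elim a b = m ⬝ᵥ a := by simp [dotProduct]
  change τ - Sum.elim m 0 ⬝ᵥ Sum.elim a b = _
  rw [hma, ← hb, dotProduct_comm, dotProduct_mulVec, ← mulVec_transpose, ha, neg_dotProduct,
    dotProduct_comm, sub_neg_eq_add]

/-- The `n × n` matrix with ones on the superdiagonal. -/
def superdiag (n : ℕ) (K : Type*) [Field K] : Matrix (Fin n) (Fin n) K :=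
  of fun i j => if (i : ℕ) + 1 = j then 1 else 0

/-- The last standard basis vector of `Kⁿ`. -/
def lastVec (n : ℕ) (K : Type*) [Field K] (i : Fin n) : K :=
  if (i : ℕ) + 1 = n then 1 else 0

/-- The identification of the index set `Fin (2n+1)` with the blocks of sizes `n`, `n`, `1`. -/
def blockEquiv (n : ℕ) : (Fin n ⊕ Fin n) ⊕ Fin 1 ≃ Fin (2 * n + 1) :=
  ((finSumFinEquiv.sumCongr (Equiv.refl _)).trans finSumFinEquiv).trans (finCongr (by omega))

theorem blockEquiv_symm_eq {n : ℕ} {i : Fin (2 * n + 1)} (hi : (i : ℕ) < n) :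
    (blockEquiv n).symm i = Sum.inl (Sum.inl ⟨i, hi⟩) := by
  rw [Equiv.symm_apply_eq]
  ext
  simp [blockEquiv]

/-- A matrix of the bordered form, with prescribed diagonal in the last `n+1` coordinates. -/
def pencilBlock {n : ℕ} {K : Type*} [Field K] (M : Matrix (Fin n) (Fin n) K) (m : Fin n → K)
    (s : ℕ → K) : Matrix ((Fin n ⊕ Fin n) ⊕ Fin 1) ((Fin n ⊕ Fin n) ⊕ Fin 1) K :=
  fromBlocks (fromBlocks 0 M Mᵀ (diagonal fun i : Fin n => s i))
    (replicateCol (Fin 1) (Sum.elim m 0)) (replicateRow (Fin 1) (Sum.elim m 0)) (of fun _ _ => s n)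

theorem pencilBlock_isSymm {n : ℕ} {K : Type*} [Field K] (M : Matrix (Fin n) (Fin n) K)
    (m : Fin n → K) (s : ℕ → K) : (pencilBlock M m s).IsSymm := by
  rw [Matrix.IsSymm, pencilBlock, fromBlocks_transpose, fromBlocks_transpose]
  simp
  rfl

/-- The representative with invariant form `∑ c_k x^k y^(2n+1-k)`. -/
def sectionPair (n : ℕ) {K : Type*} [Field K] (c : ℕ → K) : MPair n K :=
  ((pencilBlock 1 0 fun i => c (2 * i + 1)).submatrix (blockEquiv n).symm (blockEquiv n).symm,
    (pencilBlock (superdiag n K) (lastVec n K) fun i => -c (2 * i)).submatrix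
      (blockEquiv n).symm (blockEquiv n).symm)

theorem W0mem_sectionPair (n : ℕ) {K : Type*} [Field K] (c : ℕ → K) :
    W0mem n (sectionPair n c) := by
  refine ⟨⟨(pencilBlock_isSymm _ _ _).submatrix _, (pencilBlock_isSymm _ _ _).submatrix _⟩,
    fun i j hi hj => ?_⟩
  simp [sectionPair, blockEquiv_symm_eq hi, blockEquiv_symm_eq hj, pencilBlock]

theorem det_smul_one_sub_smul_superdiag (n : ℕ) {K : Type*} [Field K] (x y : K) :
    (x • (1 : Matrix (Fin n) (Fin n) K) - y • superdiag n K).det = x ^ n := by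
  rw [det_of_isUpperTriangular]
  · simp [superdiag]
  · intro i j hij
    have hij : (j : ℕ) < i := hij
    have h1 : i ≠ j := by rintro rfl; omega
    have h2 : ¬ (i : ℕ) + 1 = j := by omega
    simp [superdiag, h1, h2]

theorem smul_one_sub_smul_superdiag_mulVec (n : ℕ) {K : Type*} [Field K] {x : K} (hx : x ≠ 0)
    (y : K) :
    (x • (1 : Matrix (Fin n) (Fin n) K) - y • superdiag n K) *ᵥ
      (fun j : Fin n => -(y / x) ^ (n - (j : ℕ))) = -y • lastVec n K := by
  rw [sub_mulVec, smul_mulVec, smul_mulVec, one_mulVec]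
  ext i
  have hsum : (superdiag n K *ᵥ fun j : Fin n => -(y / x) ^ (n - (j : ℕ))) i =
      if (i : ℕ) + 1 < n then -(y / x) ^ (n - ((i : ℕ) + 1)) else 0 := by
    rw [mulVec, dotProduct]
    split_ifs with h
    · rw [Finset.sum_eq_single ⟨(i : ℕ) + 1, h⟩]
      · simp [superdiag]
      · intro j _ hj
        have : ¬ (i : ℕ) + 1 = j := fun h' => hj (Fin.ext h'.symm)
        simp [superdiag, this]
      · simp
    · refine Finset.sum_eq_zero fun j _ => ?_
      have : ¬ (i : ℕ) + 1 = j := by omega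
      simp [superdiag, this]
  simp only [Pi.sub_apply, Pi.smul_apply, smul_eq_mul, hsum, lastVec]
  have h1 : n - (i : ℕ) = n - ((i : ℕ) + 1) + 1 := by omega
  rw [h1, pow_succ]
  by_cases h : (i : ℕ) + 1 < n
  · rw [if_pos h, if_neg (by omega)]
    field_simp
    ring
  · rw [if_neg h, if_pos (by omega), show n - ((i : ℕ) + 1) = 0 by omega]
    field_simp
    ring

theorem Finset.sum_range_two_mul_eq {M : Type*} [AddCommMonoid M] (g : ℕ → M) (m : ℕ) :
    ∑ k ∈ Finset.range (2 * m), g k = ∑ j ∈ Finset.range m, (g (2 * j) + g (2 * j + 1)) := by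
  induction m with
  | zero => simp
  | succ m ih =>
    rw [mul_add, mul_one, Finset.sum_range_succ, Finset.sum_range_succ, ih, Finset.sum_range_succ,
      add_assoc]

theorem eval_invForm_sectionPair (n : ℕ) {K : Type*} [Field K] (c : ℕ → K) {x : K} (hx : x ≠ 0)
    (y : K) :
    eval ![x, y] (invForm n (sectionPair n c)) =
      ∑ k ∈ Finset.range (2 * (n + 1)), c k * x ^ k * y ^ (2 * n + 1 - k) := by
  have hpencil : x • (sectionPair n c).1 - y • (sectionPair n c).2 =
      (pencilBlock (x • 1 - y • superdiag n K) (-y • lastVec n K)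
        fun i => x * c (2 * i + 1) + y * c (2 * i)).submatrix
          (blockEquiv n).symm (blockEquiv n).symm := by
    ext i j
    simp only [sectionPair, Matrix.sub_apply, Matrix.smul_apply, submatrix_apply]
    rcases (blockEquiv n).symm i with (i | i) | i <;>
      rcases (blockEquiv n).symm j with (j | j) | j <;>
      simp [pencilBlock, diagonal_apply, one_apply]
    split_ifs <;> simp
  have h := aeval_invForm (S := K) n (sectionPair n c) x y
  simp only [Algebra.algebraMap_self, RingHom.coe_id, Matrix.map_id] at h
  have hM := det_smul_one_sub_smul_superdiag n x y
  rw [← aeval_eq_eval, h, hpencil, det_submatrix_equiv_self, pencilBlock,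
    det_fromBlocks_bordered _ _ _ _ (by rw [hM]; exact pow_ne_zero _ hx)
      (smul_one_sub_smul_superdiag_mulVec n hx y), hM, Fintype.card_fin, ← mul_assoc, ← mul_assoc,
    ← mul_pow, neg_one_mul, neg_neg, one_pow, one_mul, Finset.sum_range_two_mul_eq,
    Finset.sum_range_succ, mul_add, add_comm]
  congr 1
  · rw [← Fin.sum_univ_eq_sum_range (fun j => c (2 * j) * x ^ (2 * j) * y ^ (2 * n + 1 - 2 * j) +
      c (2 * j + 1) * x ^ (2 * j + 1) * y ^ (2 * n + 1 - (2 * j + 1))), dotProduct,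
      Finset.mul_sum]
    refine Finset.sum_congr rfl fun j _ => ?_
    obtain ⟨d, hd⟩ := Nat.exists_eq_add_of_lt j.2
    rw [mulVec_diagonal, show n - (j : ℕ) = d + 1 by omega,
      show 2 * n + 1 - 2 * (j : ℕ) = 2 * (d + 1) + 1 by omega,
      show 2 * n + 1 - (2 * (j : ℕ) + 1) = 2 * (d + 1) by omega,
      show (x ^ n) ^ 2 = x ^ (2 * (j : ℕ)) * x ^ (2 * (d + 1)) by
        rw [← pow_mul, ← pow_add]; congr 1; omega, div_pow]
    field_simp
    ring
  · rw [show 2 * n + 1 - 2 * n = 1 by omega, Nat.sub_self]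
    ring

theorem exists_W0mem_invForm_eq {K : Type*} [Field K] [Infinite K] {n : ℕ}
    {f : MvPolynomial (Fin 2) K} (hf : f.IsHomogeneous (2 * n + 1)) :
    ∃ w : MPair n K, W0mem n w ∧ invForm n w = f := by
  let p := MvPolynomial.aeval ![Polynomial.X, (1 : Polynomial K)] f
  refine ⟨sectionPair n p.coeff, W0mem_sectionPair n _, ?_⟩
  have h0 : (X 0 * X 1 : MvPolynomial (Fin 2) K) ≠ 0 := mul_ne_zero (X_ne_zero _) (X_ne_zero _)
  refine mul_left_cancel₀ h0 (MvPolynomial.funext fun z => ?_)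
  simp only [map_mul, eval_X]
  by_cases hz : z 0 * z 1 = 0
  · rw [hz, zero_mul, zero_mul]
  · obtain ⟨hx, hy⟩ := not_or.mp (mul_eq_zero.not.mp hz)
    congr 1
    have hz' : z = ![z 0, z 1] := by ext i; fin_cases i <;> rfl
    conv_lhs => rw [hz', eval_invForm_sectionPair n _ hx]
    conv_rhs => rw [← hf.homogenize_aeval_X_one]
    rw [Polynomial.eval_homogenize hf.natDegree_aeval_X_one_le _ hy,
      Polynomial.eval_eq_sum_range' (Nat.lt_succ_of_le hf.natDegree_aeval_X_one_le),
      Finset.sum_mul]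
    refine Finset.sum_congr rfl fun k hk => ?_
    obtain ⟨d, hd⟩ := Nat.exists_eq_add_of_le (Nat.le_of_lt_succ (Finset.mem_range.mp hk))
    rw [show 2 * n + 1 - k = d by omega, show 2 * n + 1 = k + d by omega, pow_add, div_pow]
    field_simp
    rfl

/-- **`G_N(K)` acts simply transitively on the fibers of `inv` on `W_N^0(K)`.**
Let `K ⊆ ℂ` be a subfield and let `f` be a binary `N`-ic form over `K` with nonzero
discriminant (equivalently, `f` is homogeneous of degree `N` and squarefree).  Then
`{(A,B) ∈ W_N^0(K) : inv(A,B) = f}` is nonempty, `G_N(K)` acts transitively on it, and all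
stabilizers are trivial. -/
theorem GN_simply_transitive_on_inv_fibers (n : ℕ) (hn : 1 ≤ n) (K : Subfield ℂ)
    (f : MvPolynomial (Fin 2) K)
    (hhom : f.IsHomogeneous (2*n+1)) (hsf : Squarefree f) :
    (∃ w : MPair n K, W0mem n w ∧ invForm n w = f) ∧
    (∀ w w' : MPair n K, W0mem n w → W0mem n w' → invForm n w = f → invForm n w' = f →
        ∃ g : Matrix (Fin (2*n+1)) (Fin (2*n+1)) K, GNmem n g ∧ actPair g w = w') ∧
    (∀ (g : Matrix (Fin (2*n+1)) (Fin (2*n+1)) K) (w : MPair n K),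
        GNmem n g → W0mem n w → invForm n w = f → actPair g w = w → g = 1) := by
  exact ⟨exists_W0mem_invForm_eq hhom,
    fun _ _ hw0 hw0' hw hw' => exists_GNmem_actPair_eq hn hhom hsf hw0 hw0' hw hw',
    fun _ _ hg hw0 hw hgw => eq_one_of_actPair_eq hn hhom hsf hg hw0 hw hgw⟩
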